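/- Let M = (M_p) be a logarithmically convex sequence of positive reals with M_0 = 1, whose quotients m_p := M_{p+1}/M_p tend to infinity, and which admits a nonzero proximate order, and let γ > ω(M). Suppose f is holomorphic in a sectorial region G_γ, bounded in every proper bounded subsector T ≪ G_γ, and M-flat in some direction θ in G_γ. Then f ≡ 0. -/

import Mathlib

open Filter Topology Set
open scoped Real

noncomputable section

/-!
We model functions on (subsets of) the Riemann surface of the logarithm through the
logarithmic chart: a point `z = e^w` of the Riemann surface (with modulus `|z| = exp (Re w)`
and argument `arg z = Im w`) corresponds to the point `w : ℂ`.  A holomorphic function `f`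
on a sector corresponds to the holomorphic function `w ↦ f (e^w)` on the corresponding
horizontal strip, and `z → 0` corresponds to `Re w → -∞`.
-/

/-- `M` is a sequence of positive reals with `M 0 = 1`, logarithmically convex,
whose sequence of quotients `m p = M (p+1) / M p` tends to infinity. -/
def GoodSeq (M : ℕ → ℝ) : Prop :=
  M 0 = 1 ∧ (∀ p, 0 < M p) ∧ (∀ p : ℕ, (M (p + 1)) ^ 2 ≤ M p * M (p + 2)) ∧
    Tendsto (fun p : ℕ => M (p + 1) / M p) atTop atTop

/-- The associated function `M(t) = sup_p log (t^p / M_p)`. -/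
def assocM (M : ℕ → ℝ) (t : ℝ) : ℝ := ⨆ p : ℕ, Real.log (t ^ p / M p)

/-- The index `ω(M) = liminf_p log (m_p) / log p`. -/
def omegaM (M : ℕ → ℝ) : ℝ :=
  Filter.liminf (fun p : ℕ => Real.log (M (p + 1) / M p) / Real.log (p : ℝ)) atTop

/-- `ρ` is a proximate order on `(c, ∞)` with limit `ℓ` at infinity:  continuous and
piecewise continuously differentiable (differentiable except possibly on a set `E` of points
that is finite below any bound, at each of which it has distinct finite lateral derivatives),
nonnegative, with `ρ(r) → ℓ` and `r ρ'(r) log r → 0` as `r → ∞`. -/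
def IsProximateOrder (c : ℝ) (ρ : ℝ → ℝ) (ℓ : ℝ) : Prop :=
  ContinuousOn ρ (Ioi c) ∧ (∀ r ∈ Ioi c, 0 ≤ ρ r) ∧ Tendsto ρ atTop (𝓝 ℓ) ∧
    ∃ (E : Set ℝ) (ρ' : ℝ → ℝ),
      (∀ R : ℝ, (E ∩ Iic R).Finite) ∧
      (∀ r ∈ Ioi c \ E, HasDerivAt ρ (ρ' r) r) ∧
      ContinuousOn ρ' (Ioi c \ E) ∧
      (∀ r ∈ E ∩ Ioi c, ∃ dl dr : ℝ, dl ≠ dr ∧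
        HasDerivWithinAt ρ dl (Iio r) r ∧ HasDerivWithinAt ρ dr (Ioi r) r) ∧
      Tendsto (fun r => r * ρ' r * Real.log r) (atTop ⊓ 𝓟 (Ioi c \ E)) (𝓝 0)

/-- The sequence `M` admits a nonzero proximate order: there are a nonzero proximate order
`ρ(t)` and constants `A ≤ B` with `A ≤ log t · (ρ(t) − d_M(t)) ≤ B` for `t` large,
where `d_M(t) = log M(t) / log t`. -/
def AdmitsNonzeroProximateOrder (M : ℕ → ℝ) : Prop :=
  ∃ (c ℓ : ℝ) (ρ : ℝ → ℝ), 0 < ℓ ∧ IsProximateOrder c ρ ℓ ∧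
    ∃ A B : ℝ, ∀ᶠ t in atTop,
      A ≤ Real.log t * (ρ t - Real.log (assocM M t) / Real.log t) ∧
      Real.log t * (ρ t - Real.log (assocM M t) / Real.log t) ≤ B

/-- The unbounded open sector `S(d, γ)` (bisecting direction `d`, opening `γπ`),
in the logarithmic chart. -/
def logSector (d γ : ℝ) : Set ℂ := {w : ℂ | |w.im - d| < γ * π / 2}

/-- The bounded open sector `S(d, γ, R)` (radius `R`), in the logarithmic chart. -/
def logSectorB (d γ R : ℝ) : Set ℂ :=
  {w : ℂ | |w.im - d| < γ * π / 2 ∧ w.re < Real.log R}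

/-- The closure of `S(d, γ, R)` in the Riemann surface of the logarithm
(the vertex is not present), in the logarithmic chart. -/
def logSectorC (d γ R : ℝ) : Set ℂ :=
  {w : ℂ | |w.im - d| ≤ γ * π / 2 ∧ w.re ≤ Real.log R}

/-- `G` is a sectorial region `G(d, γ)`: an open connected subset of `S(d, γ)` that,
for every `0 < β < γ`, contains a bounded sector `S(d, β, ρ)`. -/
def SectorialRegion (d γ : ℝ) (G : Set ℂ) : Prop :=
  IsOpen G ∧ IsConnected G ∧ G ⊆ logSector d γ ∧
    ∀ β : ℝ, 0 < β → β < γ → ∃ ρ : ℝ, 0 < ρ ∧ logSectorB d β ρ ⊆ G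

/-- The bounded sector `S(d, β, r)` is a proper subsector of `G` (written `T ≪ G`):
its closure in the Riemann surface of the logarithm is contained in `G`. -/
def ProperSubsector (G : Set ℂ) (d β r : ℝ) : Prop :=
  0 < β ∧ 0 < r ∧ logSectorC d β r ⊆ G

/-- `f` (defined on `D`) is `M`-flat in the direction `θ`: there are `r, C, A > 0` such that
the segment `(0, r e^{iθ}]` lies in `D` and `|f(z)| ≤ C A^p M_p |z|^p` on it, for all `p`. -/
def MFlatDir (M : ℕ → ℝ) (f : ℂ → ℂ) (D : Set ℂ) (θ : ℝ) : Prop :=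
  ∃ r C A : ℝ, 0 < r ∧ 0 < C ∧ 0 < A ∧
    (∀ x : ℝ, x ≤ Real.log r → (⟨x, θ⟩ : ℂ) ∈ D) ∧
    ∀ x : ℝ, x ≤ Real.log r → ∀ p : ℕ,
      ‖f ⟨x, θ⟩‖ ≤ C * A ^ p * M p * Real.exp x ^ p

/-- `f` (bounded, defined on `D`) is Beurling `M`-flat in the direction `θ`. -/
def BeurlingFlatDir (M : ℕ → ℝ) (f : ℂ → ℂ) (D : Set ℂ) (θ : ℝ) : Prop :=
  ∀ c2 : ℝ, 0 < c2 → ∃ c1 : ℝ, 0 < c1 ∧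
    ∀ w ∈ D, w.im = θ →
      ‖f w‖ ≤ c1 * Real.exp (-assocM M (1 / (c2 * Real.exp w.re)))

/-- `f` admits `Σ a_n z^n` as its `M`-asymptotic expansion in the region `G`:  on every
proper subsector `T ≪ G` there are `C, A > 0` with
`|f(z) − Σ_{n<p} a_n z^n| ≤ C A^p M_p |z|^p` for all `z ∈ T`, `p ∈ ℕ`.
(In the logarithmic chart, `z = e^w`.) -/
def AsympExpandsOn (M : ℕ → ℝ) (f : ℂ → ℂ) (a : ℕ → ℂ) (G : Set ℂ) : Prop :=
  ∀ d β r : ℝ, ProperSubsector G d β r → ∃ C A : ℝ, 0 < C ∧ 0 < A ∧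
    ∀ w ∈ logSectorB d β r, ∀ p : ℕ,
      ‖f w - ∑ n ∈ Finset.range p, a n * Complex.exp w ^ n‖
        ≤ C * A ^ p * M p * Real.exp w.re ^ p

/-- `f` admits `Σ a_n z^n` as its `M`-asymptotic expansion in the direction `θ`: there are
`r, C, A > 0` such that the segment `(0, r e^{iθ}]` lies in `G` and
`|f(z) − Σ_{n<p} a_n z^n| ≤ C A^p M_p |z|^p` on it, for all `p`. -/
def AsympExpandsDir (M : ℕ → ℝ) (f : ℂ → ℂ) (a : ℕ → ℂ) (G : Set ℂ) (θ : ℝ) : Prop :=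
  ∃ r C A : ℝ, 0 < r ∧ 0 < C ∧ 0 < A ∧
    (∀ x : ℝ, x ≤ Real.log r → (⟨x, θ⟩ : ℂ) ∈ G) ∧
    ∀ x : ℝ, x ≤ Real.log r → ∀ p : ℕ,
      ‖f (⟨x, θ⟩ : ℂ) - ∑ n ∈ Finset.range p, a n * Complex.exp (⟨x, θ⟩ : ℂ) ^ n‖
        ≤ C * A ^ p * M p * Real.exp x ^ p

/-- The derivative with respect to the base variable `z = e^w`, in the logarithmic chart:
`(d/dz) f = e^{-w} (d/dw) f`. -/
def zderiv (f : ℂ → ℂ) : ℂ → ℂ := fun w => Complex.exp (-w) * deriv f w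

/-- The filter of approach to the vertex (`z → 0`, i.e. `Re w → -∞`) within `D`. -/
def vertexFilter (D : Set ℂ) : Filter ℂ := Filter.comap Complex.re atBot ⊓ 𝓟 D

/-- The class `Ã^u_M(S)` contains no nontrivial function whose uniform `M`-asymptotic
expansion on `S` is the null power series. -/
def UniformQuasianalytic (M : ℕ → ℝ) (S : Set ℂ) : Prop :=
  ∀ f : ℂ → ℂ, DifferentiableOn ℂ f S →
    (∃ C A : ℝ, 0 < C ∧ 0 < A ∧
      ∀ w ∈ S, ∀ p : ℕ, ‖f w‖ ≤ C * A ^ p * M p * Real.exp w.re ^ p) →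
    ∀ w ∈ S, f w = 0

lemma re_exp_shift (k α : ℝ) (w : ℂ) :
    (Complex.exp (-k * (w - Complex.I * α))).re = Real.exp (-k * w.re) * Real.cos (k * (w.im - α)) := by
  rw [Complex.exp_re]
  simp

lemma norm_exp_shift (l k α : ℝ) (w : ℂ) :
    ‖Complex.exp (l * Complex.exp (-k * (w - Complex.I * α)))‖ =
      Real.exp (l * (Real.exp (-k * w.re) * Real.cos (k * (w.im - α)))) := by
  rw [Complex.norm_exp, ← re_exp_shift]
  simp

lemma pl_half_strip (F : ℂ → ℂ) (a b x1 k l K N : ℝ) (hab : a < b) (hk : 0 < k)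
    (hkab : k * (b - a) < π) (hN : 0 < N)
    (hF : ∀ w : ℂ, w.re ≤ x1 → a ≤ w.im → w.im ≤ b → DifferentiableAt ℂ F w)
    (hgrow : ∀ w : ℂ, w.re ≤ x1 → a ≤ w.im → w.im ≤ b →
      ‖F w‖ ≤ K * Real.exp (l * Real.exp (-k * w.re)))
    (h1 : ∀ w : ℂ, w.re ≤ x1 → w.im = a → ‖F w‖ ≤ N)
    (h2 : ∀ w : ℂ, w.re ≤ x1 → w.im = b → ‖F w‖ ≤ N)
    (h3 : ∀ w : ℂ, w.re = x1 → a ≤ w.im → w.im ≤ b → ‖F w‖ ≤ N) :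
    ∀ w : ℂ, w.re ≤ x1 → a ≤ w.im → w.im ≤ b → ‖F w‖ ≤ N := by
  intro w hwx hwa hwb
  have hd : 0 < b - a := by linarith
  obtain ⟨k', hkk', hk'⟩ := exists_between ((lt_div_iff₀ hd).2 hkab)
  rw [lt_div_iff₀ hd] at hk'
  have hk'0 : 0 < k' := hk.trans hkk'
  set m := (a + b) / 2 with hm
  set c0 := Real.cos (k' * (b - a) / 2) with hc0
  have hc0p : 0 < c0 := by
    apply Real.cos_pos_of_mem_Ioo
    constructor
    · have : 0 < k' * (b - a) := by positivity
      linarith [Real.pi_pos]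
    · linarith
  have hcos : ∀ y, a ≤ y → y ≤ b → c0 ≤ Real.cos (k' * (y - m)) := by
    intro y hya hyb
    rw [← Real.cos_abs (k' * (y - m))]
    apply Real.cos_le_cos_of_nonneg_of_le_pi (abs_nonneg _)
    · linarith [Real.pi_pos]
    · rw [abs_le]
      constructor <;> rw [hm] <;> nlinarith
  have hdecay : ∀ ε : ℝ, 0 < ε → ∀ᶠ x in atBot,
      K * Real.exp (l * Real.exp (-k * x)) * Real.exp (-(ε * (Real.exp (-k' * x) * c0))) ≤ N := by
    intro ε hε
    have hq : Tendsto (fun x : ℝ => Real.exp (-k * x) * (ε * c0 * Real.exp (-(k' - k) * x) - l))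
        atBot atTop := by
      apply Tendsto.atTop_mul_atTop₀
      · apply Real.tendsto_exp_atTop.comp
        exact tendsto_id.const_mul_atBot_of_neg (by linarith)
      · apply tendsto_atTop_add_const_right
        apply Tendsto.const_mul_atTop (by positivity)
        apply Real.tendsto_exp_atTop.comp
        exact tendsto_id.const_mul_atBot_of_neg (by linarith)
    have h0 : Tendsto (fun x : ℝ => K * Real.exp (-(Real.exp (-k * x) *
        (ε * c0 * Real.exp (-(k' - k) * x) - l)))) atBot (𝓝 (K * 0)) := by
      apply Tendsto.const_mul
      exact Real.tendsto_exp_neg_atTop_nhds_zero.comp hq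
    rw [mul_zero] at h0
    filter_upwards [h0.eventually (gt_mem_nhds hN)] with x hx
    refine le_trans (le_of_eq ?_) hx.le
    rw [mul_assoc, ← Real.exp_add]
    congr 2
    have : Real.exp (-k' * x) = Real.exp (-k * x) * Real.exp (-(k' - k) * x) := by
      rw [← Real.exp_add]; ring_nf
    rw [this]; ring
  have key : ∀ ε : ℝ, 0 < ε →
      ‖F w‖ * Real.exp (-ε * (Real.exp (-k' * w.re) * Real.cos (k' * (w.im - m)))) ≤ N := by
    intro ε hε
    obtain ⟨X, hX1, hX2⟩ := ((hdecay ε hε).and (eventually_lt_atBot w.re)).exists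
    set H : ℂ → ℂ := fun w => F w * Complex.exp (((-ε : ℝ) : ℂ) *
      Complex.exp (-k' * (w - Complex.I * m))) with hH
    have hHn : ∀ v, ‖H v‖ = ‖F v‖ *
        Real.exp (-ε * (Real.exp (-k' * v.re) * Real.cos (k' * (v.im - m)))) := by
      intro v
      rw [hH]; simp only [norm_mul]; rw [norm_exp_shift]
    rw [← hHn]
    have hle : ∀ v : ℂ, a ≤ v.im → v.im ≤ b → ‖H v‖ ≤ ‖F v‖ * Real.exp (-(ε * (Real.exp (-k' * v.re) * c0))) := by
      intro v hva hvb
      rw [hHn]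
      apply mul_le_mul_of_nonneg_left _ (norm_nonneg _)
      rw [Real.exp_le_exp, neg_mul]
      apply neg_le_neg
      have := hcos v.im hva hvb
      gcongr
    have hle' : ∀ v : ℂ, a ≤ v.im → v.im ≤ b → ‖H v‖ ≤ ‖F v‖ := by
      intro v hva hvb
      refine (hle v hva hvb).trans ?_
      apply mul_le_of_le_one_right (norm_nonneg _)
      rw [Real.exp_le_one_iff]
      have : 0 ≤ ε * (Real.exp (-k' * v.re) * c0) := by positivity
      linarith
    by_cases hxe : w.re = x1
    · exact (hle' w hwa hwb).trans (h3 w hxe hwa hwb)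
    have hXx : X < x1 := by linarith
    have hcl : closure (Ioo X x1 ×ℂ Ioo a b) = Icc X x1 ×ℂ Icc a b := by
      rw [Complex.closure_reProdIm, closure_Ioo hXx.ne, closure_Ioo hab.ne]
    refine Complex.norm_le_of_forall_mem_frontier_norm_le
      (U := Ioo X x1 ×ℂ Ioo a b) ?_ ?_ ?_ ?_
    · exact (Metric.isBounded_Ioo _ _).reProdIm (Metric.isBounded_Ioo _ _)
    · apply DifferentiableOn.diffContOnCl
      rw [hcl]
      rintro v ⟨⟨_, hv1⟩, hv2, hv3⟩
      have := hF v hv1 hv2 hv3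
      apply DifferentiableAt.differentiableWithinAt
      rw [hH]
      fun_prop
    · intro v hv
      have hvc : v ∈ Icc X x1 ×ℂ Icc a b := by rw [← hcl]; exact frontier_subset_closure hv
      obtain ⟨⟨hv0, hv1⟩, hv2, hv3⟩ := hvc
      have hv0' : X ≤ v.re := hv0
      have hv1' : v.re ≤ x1 := hv1
      have hv2' : a ≤ v.im := hv2
      have hv3' : v.im ≤ b := hv3
      have hvn : v ∉ Ioo X x1 ×ℂ Ioo a b := by
        intro h
        rw [IsOpen.frontier_eq (isOpen_Ioo.reProdIm isOpen_Ioo)] at hv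
        exact hv.2 h
      rcases eq_or_lt_of_le hv2' with h | h
      · exact (hle' v hv2 hv3).trans (h1 v hv1 h.symm)
      rcases eq_or_lt_of_le hv3' with h' | h'
      · exact (hle' v hv2 hv3).trans (h2 v hv1 h')
      rcases eq_or_lt_of_le hv1' with h'' | h''
      · exact (hle' v hv2 hv3).trans (h3 v h'' hv2 hv3)
      rcases eq_or_lt_of_le hv0' with h4 | h4
      · refine (hle v hv2 hv3).trans ?_
        have := hgrow v hv1 hv2 hv3
        rw [h4] at hX1
        refine le_trans ?_ hX1
        gcongr
      · exact absurd ⟨⟨h4, h''⟩, h, h'⟩ hvn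
    · rw [hcl]; exact ⟨⟨hX2.le, hwx⟩, hwa, hwb⟩
  have hlim : Tendsto (fun ε : ℝ => ‖F w‖ * Real.exp (-ε * (Real.exp (-k' * w.re) *
      Real.cos (k' * (w.im - m))))) (𝓝[>] 0) (𝓝 (‖F w‖ * Real.exp (-0 * (Real.exp (-k' * w.re) *
      Real.cos (k' * (w.im - m)))))) := by
    apply tendsto_nhdsWithin_of_tendsto_nhds
    apply Continuous.tendsto (f := fun ε : ℝ => ‖F w‖ * Real.exp (-ε * (Real.exp (-k' * w.re) *
      Real.cos (k' * (w.im - m)))))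
    fun_prop
  have := le_of_tendsto hlim (eventually_of_mem self_mem_nhdsWithin key)
  simpa using this

/-- transfer of flatness -/
lemma flat_transfer (f : ℂ → ℂ) (a b x1 k l α K N : ℝ) (hab : a < b) (hk : 0 < k)
    (hkab : k * (b - a) < π) (hN : 0 < N) (hl : 0 ≤ l)
    (hF : ∀ w : ℂ, w.re ≤ x1 → a ≤ w.im → w.im ≤ b → DifferentiableAt ℂ f w)
    (hK : ∀ w : ℂ, w.re ≤ x1 → a ≤ w.im → w.im ≤ b → ‖f w‖ ≤ K)
    (hKN : K * Real.exp (l * Real.exp (-k * x1)) ≤ N)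
    (h1 : ∀ w : ℂ, w.re ≤ x1 → w.im = a →
      ‖f w‖ * Real.exp (l * (Real.exp (-k * w.re) * Real.cos (k * (a - α)))) ≤ N)
    (h2 : ∀ w : ℂ, w.re ≤ x1 → w.im = b →
      ‖f w‖ * Real.exp (l * (Real.exp (-k * w.re) * Real.cos (k * (b - α)))) ≤ N) :
    ∀ w : ℂ, w.re ≤ x1 → a ≤ w.im → w.im ≤ b →
      ‖f w‖ * Real.exp (l * (Real.exp (-k * w.re) * Real.cos (k * (w.im - α)))) ≤ N := by
  set F : ℂ → ℂ := fun w => f w * Complex.exp ((l : ℂ) * Complex.exp (-k * (w - Complex.I * α)))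
    with hFd
  have hFn : ∀ v, ‖F v‖ = ‖f v‖ *
      Real.exp (l * (Real.exp (-k * v.re) * Real.cos (k * (v.im - α)))) := by
    intro v
    rw [hFd]; simp only [norm_mul]; rw [norm_exp_shift]
  have hgrow : ∀ w : ℂ, w.re ≤ x1 → a ≤ w.im → w.im ≤ b →
      ‖F w‖ ≤ K * Real.exp (l * Real.exp (-k * w.re)) := by
    intro w h h' h''
    rw [hFn]
    have hKw := hK w h h' h''
    have hK0 : 0 ≤ K := (norm_nonneg _).trans hKw
    have : Real.exp (-k * w.re) * Real.cos (k * (w.im - α)) ≤ Real.exp (-k * w.re) :=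
      mul_le_of_le_one_right (Real.exp_pos _).le (Real.cos_le_one _)
    gcongr
  have := pl_half_strip F a b x1 k l K N hab hk hkab hN ?_ hgrow ?_ ?_ ?_
  · intro w h h' h''
    rw [← hFn]; exact this w h h' h''
  · intro w h h' h''
    have := hF w h h' h''
    rw [hFd]; fun_prop
  · intro w h h'
    rw [hFn, h']; exact h1 w h h'
  · intro w h h'
    rw [hFn, h']; exact h2 w h h'
  · intro w h h' h''
    refine (hgrow w h.le h' h'').trans ?_
    rw [h]; exact hKN

lemma seq_log_le {M : ℕ → ℝ} (hM : GoodSeq M) {t : ℝ} (ht : 0 < t) (P : ℕ)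
    (hP : ∀ q, P ≤ q → t ≤ M (q + 1) / M q) (p : ℕ) :
    ∃ p' ≤ P, Real.log (t ^ p / M p) ≤ Real.log (t ^ p' / M p') := by
  obtain ⟨-, hpos, -, -⟩ := hM
  rcases le_total p P with h | h
  · exact ⟨p, h, le_rfl⟩
  refine ⟨P, le_rfl, ?_⟩
  induction p, h using Nat.le_induction with
  | base => exact le_rfl
  | succ q hq ih =>
    refine le_trans ?_ ih
    have h1 := hpos q
    have h2 := hpos (q + 1)
    apply Real.log_le_log (by positivity)
    have := hP q hq
    rw [le_div_iff₀ h1] at this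
    rw [div_le_div_iff₀ h2 h1, pow_succ, mul_assoc]
    gcongr

lemma seq_bdd {M : ℕ → ℝ} (hM : GoodSeq M) {t : ℝ} (ht : 0 < t) :
    BddAbove (range fun p : ℕ => Real.log (t ^ p / M p)) := by
  obtain ⟨P, hP⟩ := eventually_atTop.1 (hM.2.2.2.eventually_ge_atTop t)
  obtain ⟨B, hB⟩ := ((Finset.range (P + 1)).image
    (fun p : ℕ => Real.log (t ^ p / M p))).bddAbove
  refine ⟨B, ?_⟩
  rintro _ ⟨p, rfl⟩
  obtain ⟨p', hp', h⟩ := seq_log_le hM ht P hP p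
  refine h.trans (hB ?_)
  simp only [Finset.coe_image, Set.mem_image, Finset.coe_range, Set.mem_Iio]
  exact ⟨p', by omega, rfl⟩

lemma assoc_nonneg {M : ℕ → ℝ} (hM : GoodSeq M) {t : ℝ} (ht : 0 < t) : 0 ≤ assocM M t := by
  have := le_ciSup (seq_bdd hM ht) 0
  simpa [hM.1, assocM] using this

lemma quot_mono {M : ℕ → ℝ} (hM : GoodSeq M) : Monotone fun p : ℕ => M (p + 1) / M p := by
  apply monotone_nat_of_le_succ
  intro p
  obtain ⟨-, hpos, hlc, -⟩ := hM
  rw [div_le_div_iff₀ (hpos _) (hpos _)]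
  have := hlc p
  nlinarith

lemma seq_le_pow {M : ℕ → ℝ} (hM : GoodSeq M) (p : ℕ) :
    M (p + 1) ≤ (M (p + 1) / M p) ^ (p + 1) := by
  have hpos := hM.2.1
  induction p with
  | zero => simp [hM.1]
  | succ p ih =>
    have h := quot_mono hM (Nat.le_succ p)
    simp only [Nat.succ_eq_add_one] at h
    have h0 : 0 < M (p + 1) / M p := div_pos (hpos _) (hpos _)
    have h1 : 0 < M (p + 1 + 1) / M (p + 1) := div_pos (hpos _) (hpos _)
    calc M (p + 1 + 1) = M (p + 1) * (M (p + 1 + 1) / M (p + 1)) := by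
          field_simp [(hpos (p + 1)).ne']
      _ ≤ (M (p + 1) / M p) ^ (p + 1) * (M (p + 1 + 1) / M (p + 1)) := by gcongr
      _ ≤ (M (p + 1 + 1) / M (p + 1)) ^ (p + 1) * (M (p + 1 + 1) / M (p + 1)) := by gcongr
      _ = _ := by rw [← pow_succ]

lemma pow_le_seq {M : ℕ → ℝ} (hM : GoodSeq M) (p : ℕ) : (M 1) ^ p ≤ M p := by
  have hpos := hM.2.1
  induction p with
  | zero => simp [hM.1]
  | succ p ih =>
    have h := quot_mono hM (Nat.zero_le p)
    simp only [zero_add, hM.1, div_one] at h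
    rw [le_div_iff₀ (hpos p)] at h
    have := hpos 1
    rw [pow_succ']
    refine le_trans ?_ h
    gcongr

lemma le_assoc_quot {M : ℕ → ℝ} (hM : GoodSeq M) (p : ℕ) :
    (p : ℝ) + 1 ≤ assocM M (Real.exp 1 * (M (p + 1) / M p)) := by
  have hpos := hM.2.1
  have h0 : 0 < M (p + 1) / M p := div_pos (hpos _) (hpos _)
  have ht : 0 < Real.exp 1 * (M (p + 1) / M p) := by positivity
  refine le_trans ?_ (le_ciSup (seq_bdd hM ht) (p + 1))
  rw [Real.le_log_iff_exp_le (div_pos (pow_pos ht _) (hpos _)), le_div_iff₀ (hpos _), mul_pow,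
    ← Real.exp_nat_mul]
  push_cast
  rw [mul_one]
  gcongr
  exact seq_le_pow hM p

lemma assoc_tendsto {M : ℕ → ℝ} {ℓ A B : ℝ} {ρ : ℝ → ℝ} (hρ : Tendsto ρ atTop (𝓝 ℓ))
    (h : ∀ᶠ t in atTop, A ≤ Real.log t * (ρ t - Real.log (assocM M t) / Real.log t) ∧
      Real.log t * (ρ t - Real.log (assocM M t) / Real.log t) ≤ B) :
    Tendsto (fun t => Real.log (assocM M t) / Real.log t) atTop (𝓝 ℓ) := by
  have h0 : ∀ a : ℝ, Tendsto (fun t => ρ t - a / Real.log t) atTop (𝓝 ℓ) := by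
    intro a
    have := hρ.sub (Real.tendsto_log_atTop.const_div_atTop a)
    simpa using this
  refine tendsto_of_tendsto_of_tendsto_of_le_of_le' (h0 B) (h0 A) ?_ ?_
  · filter_upwards [h, Real.tendsto_log_atTop.eventually_gt_atTop 0] with t ht hl
    have := (le_div_iff₀' hl).2 ht.2
    linarith
  · filter_upwards [h, Real.tendsto_log_atTop.eventually_gt_atTop 0] with t ht hl
    have := (div_le_iff₀' hl).2 ht.1
    linarith

lemma assoc_ge {M : ℕ → ℝ} (hM : GoodSeq M) {ℓ k : ℝ} (hk0 : 0 < k) (hk : k < ℓ)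
    (h : Tendsto (fun t => Real.log (assocM M t) / Real.log t) atTop (𝓝 ℓ)) :
    ∀ᶠ t in atTop, t ^ k ≤ assocM M t := by
  filter_upwards [h.eventually (lt_mem_nhds hk), eventually_gt_atTop 0,
    Real.tendsto_log_atTop.eventually_gt_atTop 0] with t ht h0 hl
  rw [lt_div_iff₀ hl] at ht
  have hp : 0 < assocM M t := by
    rcases (assoc_nonneg hM h0).lt_or_eq with h | h
    · exact h
    · rw [← h, Real.log_zero] at ht
      have : 0 < k * Real.log t := by positivity
      linarith
  rw [Real.rpow_def_of_pos h0, ← Real.le_log_iff_exp_le hp, mul_comm]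
  exact ht.le

lemma assoc_le {M : ℕ → ℝ} (hM : GoodSeq M) {ℓ k : ℝ} (hk : ℓ < k)
    (h : Tendsto (fun t => Real.log (assocM M t) / Real.log t) atTop (𝓝 ℓ)) :
    ∀ᶠ t in atTop, assocM M t ≤ t ^ k := by
  filter_upwards [h.eventually (gt_mem_nhds hk), eventually_gt_atTop 0,
    Real.tendsto_log_atTop.eventually_gt_atTop 0] with t ht h0 hl
  rw [div_lt_iff₀ hl] at ht
  rcases (assoc_nonneg hM h0).lt_or_eq with h | h
  · rw [Real.rpow_def_of_pos h0, ← Real.log_le_iff_le_exp h, mul_comm]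
    exact ht.le
  · rw [← h]; positivity

lemma quot_cobdd {M : ℕ → ℝ} (hM : GoodSeq M) {ℓ : ℝ} (hℓ : 0 < ℓ)
    (h : Tendsto (fun t => Real.log (assocM M t) / Real.log t) atTop (𝓝 ℓ)) :
    ∃ᶠ p : ℕ in atTop, Real.log (M (p + 1) / M p) / Real.log (p : ℝ) ≤ 4 / ℓ := by
  intro hcon
  have hpos := hM.2.1
  obtain ⟨P, hP⟩ := eventually_atTop.1 (hcon.and (eventually_ge_atTop 2))
  set D : ℝ := P + 1 with hD
  set C : ℝ := |Real.log (M 1)| with hC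
  have hr : Tendsto (fun t : ℝ => t ^ (ℓ / 4)) atTop atTop := tendsto_rpow_atTop (by positivity)
  have e1 := hr.eventually_ge_atTop D
  have e2 := hr.eventually_ge_atTop (8 * C)
  have e3 := (isLittleO_log_rpow_atTop (r := ℓ / 4) (by positivity)).bound
    (show (0 : ℝ) < 1 / 8 by norm_num)
  obtain ⟨t, h1, h2, h3, h4, h5⟩ := (e1.and (e2.and (e3.and ((assoc_ge hM (k := ℓ / 2)
    (by positivity) (by linarith) h).and (eventually_gt_atTop 1))))).exists
  have ht : 0 < t := by linarith
  have hl : 0 < Real.log t := Real.log_pos h5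
  set s := t ^ (ℓ / 4) with hs
  have hs0 : 0 < s := by positivity
  have hss : t ^ (ℓ / 2) = s * s := by rw [hs, ← Real.rpow_add ht]; ring_nf
  rw [Real.norm_of_nonneg hl.le, Real.norm_of_nonneg hs0.le] at h3
  set Q := ⌈s⌉₊ + P with hQ
  have hQs : (Q : ℝ) ≤ s + D := by
    rw [hQ, hD]; push_cast
    have := (Nat.ceil_lt_add_one hs0.le).le
    linarith
  have hbig : ∀ q, Q ≤ q → t ≤ M (q + 1) / M q := by
    intro q hq
    obtain ⟨hq1, hq2⟩ := hP q (by omega)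
    rw [not_le] at hq1
    have hqR : (2 : ℝ) ≤ q := by exact_mod_cast hq2
    have hlq : 0 < Real.log q := Real.log_pos (by linarith)
    rw [lt_div_iff₀ hlq] at hq1
    have hsq : s ≤ q := (Nat.le_ceil s).trans (by exact_mod_cast (by omega : ⌈s⌉₊ ≤ q))
    have hls : Real.log s ≤ Real.log q := Real.log_le_log hs0 hsq
    rw [hs, Real.log_rpow ht] at hls
    rw [← Real.log_le_log_iff ht (div_pos (hpos _) (hpos _))]
    have : Real.log t = 4 / ℓ * (ℓ / 4 * Real.log t) := by field_simp
    rw [this]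
    refine le_trans ?_ hq1.le
    gcongr
  have hup : assocM M t ≤ Q * (Real.log t + C) := by
    apply ciSup_le
    intro p
    obtain ⟨p', hp', hle⟩ := seq_log_le hM ht Q hbig p
    refine hle.trans ?_
    have h1pos := hpos 1
    have hlog : Real.log (t ^ p' / M p') ≤ p' * (Real.log t + C) := by
      rw [Real.log_div (by positivity) (hpos p').ne', Real.log_pow]
      have := Real.log_le_log (by positivity) (pow_le_seq hM p')
      rw [Real.log_pow] at this
      have h6 : -C ≤ Real.log (M 1) := neg_abs_le _
      have h7 : (p' : ℝ) * (-C) ≤ p' * Real.log (M 1) := by gcongr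
      linarith
    refine hlog.trans ?_
    have : (p' : ℝ) ≤ Q := by exact_mod_cast hp'
    have hC0 : 0 ≤ C := abs_nonneg _
    gcongr
  rw [hss] at h4
  have hC0 : 0 ≤ C := abs_nonneg _
  have : (Q : ℝ) * (Real.log t + C) ≤ (2 * s) * (s / 4) := by
    apply mul_le_mul <;> linarith
  nlinarith

lemma inv_le_omega {M : ℕ → ℝ} (hM : GoodSeq M) {ℓ : ℝ} (hℓ : 0 < ℓ)
    (h : Tendsto (fun t => Real.log (assocM M t) / Real.log t) atTop (𝓝 ℓ)) :
    1 / ℓ ≤ omegaM M := by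
  have hpos := hM.2.1
  apply le_of_forall_lt_imp_le_of_dense
  intro s hs
  have : ∃ κ, ℓ < κ ∧ s < 1 / κ := by
    have hc : ContinuousAt (fun κ : ℝ => 1 / κ) ℓ := by
      apply ContinuousAt.div continuousAt_const continuousAt_id hℓ.ne'
    have : ∀ᶠ κ in 𝓝[>] ℓ, s < 1 / κ :=
      (hc.eventually (lt_mem_nhds hs)).filter_mono nhdsWithin_le_nhds
    obtain ⟨κ, h1, h2⟩ := (this.and self_mem_nhdsWithin).exists
    exact ⟨κ, h2, h1⟩
  obtain ⟨κ, hκ, hsκ⟩ := this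
  have hκ0 : 0 < κ := hℓ.trans hκ
  apply le_liminf_of_le (IsCoboundedUnder.of_frequently_le (quot_cobdd hM hℓ h))
  have ht : Tendsto (fun p : ℕ => Real.exp 1 * (M (p + 1) / M p)) atTop atTop :=
    hM.2.2.2.const_mul_atTop (Real.exp_pos 1)
  have hlogn : Tendsto (fun p : ℕ => Real.log (p : ℝ)) atTop atTop :=
    Real.tendsto_log_atTop.comp tendsto_natCast_atTop_atTop
  have hinv : Tendsto (fun p : ℕ => 1 / κ - 1 / Real.log (p : ℝ)) atTop (𝓝 (1 / κ - 0)) :=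
    tendsto_const_nhds.sub (hlogn.const_div_atTop 1)
  rw [sub_zero] at hinv
  filter_upwards [ht.eventually (assoc_le hM hκ h), hlogn.eventually_gt_atTop 0,
    hinv.eventually (lt_mem_nhds hsκ), eventually_ge_atTop 1] with p h1 h2 h3 h4
  have h5 := (le_assoc_quot hM p).trans h1
  have hq0 : 0 < M (p + 1) / M p := div_pos (hpos _) (hpos _)
  have hp0 : (0 : ℝ) < p := by exact_mod_cast h4
  have h6 := Real.log_le_log hp0 ((by linarith : (p : ℝ) ≤ p + 1).trans h5)
  rw [Real.log_rpow (by positivity), Real.log_mul (Real.exp_pos 1).ne' hq0.ne', Real.log_exp] at h6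
  refine h3.le.trans ?_
  rw [le_div_iff₀ h2, sub_mul, div_mul_cancel₀ _ h2.ne', div_mul_eq_mul_div, one_mul,
    sub_le_iff_le_add, div_le_iff₀ hκ0]
  linarith

lemma flat_up (f : ℂ → ℂ) (a b x1 k c C K y0 : ℝ) (hay : a < y0) (hyb : y0 < b) (hk : 0 < k)
    (hkab : k * (b - a) < π) (hc : 0 < c) (hC : 0 < C)
    (hF : ∀ w : ℂ, w.re ≤ x1 → a ≤ w.im → w.im ≤ b → DifferentiableAt ℂ f w)
    (hK : ∀ w : ℂ, w.re ≤ x1 → a ≤ w.im → w.im ≤ b → ‖f w‖ ≤ K)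
    (hflat : ∀ w : ℂ, w.re ≤ x1 → w.im = a → ‖f w‖ ≤ C * Real.exp (-(c * Real.exp (-k * w.re)))) :
    ∃ C' c' : ℝ, 0 < C' ∧ 0 < c' ∧ ∀ w : ℂ, w.re ≤ x1 → w.im = y0 →
      ‖f w‖ ≤ C' * Real.exp (-(c' * Real.exp (-k * w.re))) := by
  have hab : a < b := hay.trans hyb
  have hs : 0 < Real.sin (k * (b - a)) :=
    Real.sin_pos_of_pos_of_lt_pi (mul_pos hk (by linarith)) hkab
  have hs' : 0 < Real.sin (k * (b - y0)) :=
    Real.sin_pos_of_pos_of_lt_pi (mul_pos hk (by linarith)) (by nlinarith)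
  set l := c / Real.sin (k * (b - a)) with hl
  have hl0 : 0 < l := by positivity
  have hcos : ∀ y, Real.cos (k * (y - (b - π / (2 * k)))) = Real.sin (k * (b - y)) := by
    intro y
    rw [← Real.cos_pi_div_two_sub]
    congr 1
    field_simp
    ring
  set N := max C K * Real.exp (l * Real.exp (-k * x1)) with hN
  have hmax : 0 < max C K := lt_max_of_lt_left hC
  have hone : 1 ≤ Real.exp (l * Real.exp (-k * x1)) := Real.one_le_exp (by positivity)
  have hmN : max C K ≤ N := le_mul_of_one_le_right hmax.le hone
  have key := flat_transfer f a b x1 k l (b - π / (2 * k)) K N hab hk hkab (by positivity) hl0.le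
    hF hK (by rw [hN]; gcongr; exact le_max_right _ _) ?_ ?_
  · refine ⟨N, l * Real.sin (k * (b - y0)), by positivity, by positivity, ?_⟩
    intro w hw hwy
    have := key w hw (by linarith) (by linarith)
    rw [hcos, hwy] at this
    rw [Real.exp_neg, ← div_eq_mul_inv, le_div_iff₀ (Real.exp_pos _)]
    refine le_trans (le_of_eq ?_) this
    ring_nf
  · intro w hw hwa
    rw [hcos]
    refine le_trans ?_ ((le_max_left C K).trans hmN)
    have h1 := hflat w hw hwa
    rw [Real.exp_neg, ← div_eq_mul_inv, le_div_iff₀ (Real.exp_pos _)] at h1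
    refine le_trans (le_of_eq ?_) h1
    congr 2
    rw [hl]; field_simp
  · intro w hw hwb
    rw [hcos]
    refine le_trans ?_ ((le_max_right C K).trans hmN)
    simpa using hK w hw (by linarith) (by linarith)

lemma flat_zero (f : ℂ → ℂ) (a b x1 k c C K : ℝ) (hk : 0 < k)
    (hkab : a ≤ b - π / k) (hc : 0 < c) (hC : 0 < C)
    (hF : ∀ w : ℂ, w.re ≤ x1 → a ≤ w.im → w.im ≤ b → DifferentiableAt ℂ f w)
    (hK : ∀ w : ℂ, w.re ≤ x1 → a ≤ w.im → w.im ≤ b → ‖f w‖ ≤ K)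
    (hflat : ∀ w : ℂ, w.re ≤ x1 → w.im = b → ‖f w‖ ≤ C * Real.exp (-(c * Real.exp (-k * w.re)))) :
    ∀ w : ℂ, w.re < x1 → w.im = b - π / (2 * k) → f w = 0 := by
  intro w hw hwy
  have hmax : 0 < max C K := lt_max_of_lt_left hC
  have key : ∀ ε : ℝ, 0 < ε → ε < π / 2 → ‖f w‖ ≤ max C K * Real.exp (-(c * (Real.sin ε)⁻¹ *
      (Real.exp (-k * w.re) * Real.cos ε - Real.exp (-k * x1)))) := by
    intro ε hε hε2
    have hs : 0 < Real.sin ε := Real.sin_pos_of_pos_of_lt_pi hε (by linarith)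
    have hεk : 0 < ε / k := by positivity
    have hpk : ε / k < π / (2 * k) := by
      rw [div_lt_div_iff₀ hk (by positivity)]; nlinarith
    have hpk2 : π / k = π / (2 * k) + π / (2 * k) := by field_simp; ring
    set l := c * (Real.sin ε)⁻¹ with hl
    have hl0 : 0 < l := by positivity
    set N := max C K * Real.exp (l * Real.exp (-k * x1)) with hN
    have hone : 1 ≤ Real.exp (l * Real.exp (-k * x1)) := Real.one_le_exp (by positivity)
    have hmN : max C K ≤ N := le_mul_of_one_le_right hmax.le hone
    set a1 := b - π / k + ε / k with ha1
    set α := b - π / (2 * k) + ε / k with hα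
    have hca : Real.cos (k * (a1 - α)) = 0 := by
      rw [show k * (a1 - α) = -(π / 2) by rw [ha1, hα]; field_simp; ring, Real.cos_neg,
        Real.cos_pi_div_two]
    have hcb : Real.cos (k * (b - α)) = Real.sin ε := by
      rw [show k * (b - α) = π / 2 - ε by rw [hα]; field_simp; ring, Real.cos_pi_div_two_sub]
    have hcy : Real.cos (k * (w.im - α)) = Real.cos ε := by
      rw [hwy, show k * (b - π / (2 * k) - α) = -ε by rw [hα]; field_simp; ring, Real.cos_neg]
    have hw' := flat_transfer f a1 b x1 k l α K N (by linarith) hk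
      (by rw [show k * (b - a1) = π - ε by rw [ha1]; field_simp; ring]; linarith)
      (by positivity) hl0.le
      (fun v h1 h2 h3 => hF v h1 (by linarith) h3) (fun v h1 h2 h3 => hK v h1 (by linarith) h3)
      (by rw [hN]; gcongr; exact le_max_right _ _) ?_ ?_ w hw.le (by linarith) (by linarith)
    · rw [hcy, hN, ← le_div_iff₀ (Real.exp_pos _), mul_div_assoc, ← Real.exp_sub] at hw'
      refine hw'.trans (le_of_eq ?_)
      ring_nf
    · intro v hv hva
      rw [hca]
      refine le_trans ?_ ((le_max_right C K).trans hmN)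
      simpa using hK v hv (by linarith) (by linarith)
    · intro v hv hvb
      rw [hcb]
      refine le_trans ?_ ((le_max_left C K).trans hmN)
      have h1 := hflat v hv hvb
      rw [Real.exp_neg, ← div_eq_mul_inv, le_div_iff₀ (Real.exp_pos _)] at h1
      refine le_trans (le_of_eq ?_) h1
      congr 2
      rw [hl]; field_simp
  have hsin : Tendsto (fun ε : ℝ => c * (Real.sin ε)⁻¹) (𝓝[>] 0) atTop := by
    apply Tendsto.const_mul_atTop hc
    apply Tendsto.comp tendsto_inv_nhdsGT_zero
    rw [tendsto_nhdsWithin_iff]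
    constructor
    · have := (Real.continuous_sin.tendsto 0).mono_left (nhdsWithin_le_nhds (s := Ioi 0))
      simpa using this
    · filter_upwards [Ioo_mem_nhdsGT Real.pi_pos] with ε hε
      exact Real.sin_pos_of_pos_of_lt_pi hε.1 hε.2
  have hcosl : Tendsto (fun ε : ℝ => Real.exp (-k * w.re) * Real.cos ε - Real.exp (-k * x1))
      (𝓝[>] 0) (𝓝 (Real.exp (-k * w.re) - Real.exp (-k * x1))) := by
    have hcont : Continuous fun ε : ℝ =>
      Real.exp (-k * w.re) * Real.cos ε - Real.exp (-k * x1) := by fun_prop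
    have := (hcont.tendsto 0).mono_left (nhdsWithin_le_nhds (s := Ioi 0))
    simpa using this
  have hpos : 0 < Real.exp (-k * w.re) - Real.exp (-k * x1) := by
    rw [sub_pos, Real.exp_lt_exp]; nlinarith
  have hlim := (Real.tendsto_exp_neg_atTop_nhds_zero.comp
    (hsin.atTop_mul_pos hpos hcosl)).const_mul (max C K)
  rw [mul_zero] at hlim
  have : ‖f w‖ ≤ 0 := by
    apply ge_of_tendsto hlim
    filter_upwards [Ioo_mem_nhdsGT (show (0 : ℝ) < π / 2 by positivity)] with ε hε
    exact key ε hε.1 hε.2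
  exact norm_le_zero_iff.1 this

lemma flat_bound {M : ℕ → ℝ} (hM : GoodSeq M) {k C A x n : ℝ} (hC : 0 < C) (hA : 0 < A)
    (hn : 0 ≤ n) (h : ∀ p : ℕ, n ≤ C * A ^ p * M p * Real.exp x ^ p)
    (hk : (1 / A * Real.exp (-x)) ^ k ≤ assocM M (1 / A * Real.exp (-x))) :
    n ≤ C * Real.exp (-((1 / A) ^ k * Real.exp (-k * x))) := by
  rcases hn.eq_or_lt with h0 | h0
  · rw [← h0]; positivity
  have hpow : (1 / A * Real.exp (-x)) ^ k = (1 / A) ^ k * Real.exp (-k * x) := by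
    rw [Real.mul_rpow (by positivity) (Real.exp_pos _).le, ← Real.exp_mul]
    ring_nf
  rw [hpow] at hk
  have hup : assocM M (1 / A * Real.exp (-x)) ≤ Real.log (C / n) := by
    apply ciSup_le
    intro p
    have hMp := hM.2.1 p
    apply Real.log_le_log (by positivity)
    rw [div_le_div_iff₀ hMp h0, mul_pow, Real.exp_neg, one_div, inv_pow, inv_pow]
    have := h p
    have h1 : 0 < A ^ p := by positivity
    have h2 : 0 < Real.exp x ^ p := by positivity
    rw [← mul_inv, inv_mul_le_iff₀ (by positivity)]
    linarith
  have h3 := hk.trans hup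
  rw [Real.le_log_iff_exp_le (by positivity), le_div_iff₀ h0] at h3
  rw [Real.exp_neg, ← div_eq_mul_inv, le_div_iff₀ (Real.exp_pos _)]
  linarith

/-- Proposition 4.5 of the paper, Watson's lemma in sectorial regions:
for `γ > ω(M)`, if `f` is holomorphic in a sectorial region `G_γ`, bounded in every proper
bounded subsector `T ≪ G_γ`, and `M`-flat in some direction `θ` of `G_γ`, then `f ≡ 0`. -/
theorem watson_sectorial_region
    (M : ℕ → ℝ) (hM : GoodSeq M) (hPO : AdmitsNonzeroProximateOrder M)
    (γ : ℝ) (hγ0 : 0 < γ) (hγω : omegaM M < γ)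
    (G : Set ℂ) (hG : SectorialRegion 0 γ G)
    (f : ℂ → ℂ) (hf : DifferentiableOn ℂ f G)
    (hbd : ∀ d β r : ℝ, ProperSubsector G d β r →
      ∃ K : ℝ, ∀ w ∈ logSectorB d β r, ‖f w‖ ≤ K)
    (θ : ℝ) (hθ : |θ| < γ * π / 2) (hflat : MFlatDir M f G θ) :
    ∀ w ∈ G, f w = 0 := by
  obtain ⟨cc, ℓ, ρ, hℓ, ⟨-, -, hρ, -⟩, A0, B0, hAB⟩ := hPO
  have hd := assoc_tendsto hρ hAB
  have hω := inv_le_omega hM hℓ hd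
  obtain ⟨hGo, hGc, hGs, hGβ⟩ := hG
  obtain ⟨r, C, A, hr, hC, hA, hray, hfl⟩ := hflat
  have hθ' := abs_lt.1 hθ
  have hpi := Real.pi_pos
  have hγℓ : 1 / γ < ℓ := by
    rw [div_lt_iff₀ hγ0]
    have : 1 / ℓ < γ := hω.trans_lt hγω
    rw [div_lt_iff₀ hℓ] at this
    linarith
  have hgap : 0 < γ * π / 2 - θ := by linarith
  have hγ2 : 1 / γ < π / (γ * π / 2 - θ) := by
    rw [div_lt_div_iff₀ hγ0 hgap]; linarith
  obtain ⟨k, hk1, hk2⟩ := exists_between (lt_min hγℓ hγ2)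
  have hkℓ : k < ℓ := hk2.trans_le (min_le_left _ _)
  have hkθ : k * (γ * π / 2 - θ) < π := by
    have := hk2.trans_le (min_le_right _ _)
    rwa [lt_div_iff₀ hgap] at this
  have hk0 : 0 < k := lt_trans (by positivity) hk1
  have hkγ : 1 / k < γ := by
    rw [div_lt_iff₀ hγ0] at hk1
    rw [div_lt_iff₀ hk0]; linarith
  have hθγ : 2 * |θ| / π < γ := by rw [div_lt_iff₀ hpi]; linarith
  obtain ⟨β, hβ1, hβγ⟩ := exists_between (max_lt hkγ hθγ)
  have hβk : 1 / k < β := (le_max_left _ _).trans_lt hβ1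
  have hβθ : |θ| < β * π / 2 := by
    have := (le_max_right _ _).trans_lt hβ1
    rw [div_lt_iff₀ hpi] at this; linarith
  have hβ0 : 0 < β := lt_trans (by positivity) hβk
  obtain ⟨β1, hββ1, hβ1γ⟩ := exists_between hβγ
  obtain ⟨β2, hβ12, hβ2γ⟩ := exists_between hβ1γ
  obtain ⟨R, hR, hRG⟩ := hGβ β2 (by linarith) hβ2γ
  have hsub : logSectorC 0 β1 (R / 2) ⊆ G := by
    intro w hw
    apply hRG
    have hw1 : |w.im - 0| ≤ β1 * π / 2 := hw.1
    have hw2 : w.re ≤ Real.log (R / 2) := hw.2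
    refine ⟨hw1.trans_lt (by nlinarith), hw2.trans_lt (Real.log_lt_log (by linarith) (by linarith))⟩
  obtain ⟨K, hK⟩ := hbd 0 β1 (R / 2) ⟨by linarith, by linarith, hsub⟩
  have hev : ∀ᶠ x : ℝ in atBot, (1 / A * Real.exp (-x)) ^ k ≤ assocM M (1 / A * Real.exp (-x)) := by
    have : Tendsto (fun x : ℝ => 1 / A * Real.exp (-x)) atBot atTop :=
      (Real.tendsto_exp_atTop.comp tendsto_neg_atBot_atTop).const_mul_atTop (by positivity)
    exact this.eventually (assoc_ge hM hk0 hkℓ hd)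
  obtain ⟨x2, hx2⟩ := eventually_atBot.1 hev
  obtain ⟨x1, hx1⟩ := ((eventually_le_atBot x2).and ((eventually_le_atBot (Real.log r)).and
    (eventually_lt_atBot (Real.log (R / 2))))).exists
  obtain ⟨hx12, hx1r, hx1R⟩ := hx1
  set T := β * π / 2 with hT
  have hTβ1 : T < β1 * π / 2 := by nlinarith
  have hmem : ∀ w : ℂ, w.re ≤ x1 → -T ≤ w.im → w.im ≤ T → w ∈ logSectorB 0 β1 (R / 2) := by
    intro w h1 h2 h3
    refine ⟨?_, by linarith⟩
    rw [sub_zero, abs_lt]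
    constructor <;> linarith
  have hBG : logSectorB 0 β1 (R / 2) ⊆ G := fun w hw => hsub ⟨hw.1.le, hw.2.le⟩
  have hdiff : ∀ w ∈ G, DifferentiableAt ℂ f w := fun w hw =>
    (hf w hw).differentiableAt (hGo.mem_nhds hw)
  have hθT := abs_lt.1 hβθ
  have hflatθ : ∀ w : ℂ, w.re ≤ x1 → w.im = θ →
      ‖f w‖ ≤ C * Real.exp (-((1 / A) ^ k * Real.exp (-k * w.re))) := by
    intro w h1 h2
    have hw : w = ⟨w.re, θ⟩ := by rw [← h2]
    apply flat_bound hM hC hA (norm_nonneg _) _ (hx2 _ (h1.trans hx12))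
    intro p
    have := hfl w.re (h1.trans hx1r) p
    rwa [← hw] at this
  have hpk : π / k < 2 * T := by
    rw [hT, div_lt_iff₀ hk0]
    rw [div_lt_iff₀ hk0] at hβk
    nlinarith
  obtain ⟨y0, hy1, hy2⟩ := exists_between (max_lt hθT.2 (show π / k - T < T by linarith))
  have hyθ : θ < y0 := (le_max_left _ _).trans_lt hy1
  have hyk : π / k - T < y0 := (le_max_right _ _).trans_lt hy1
  obtain ⟨C', c', hC', hc', hflat'⟩ := flat_up f θ T x1 k ((1 / A) ^ k) C K y0 hyθ hy2 hk0
    (lt_of_le_of_lt (mul_le_mul_of_nonneg_left (by nlinarith) hk0.le) hkθ) (by positivity) hC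
    (fun w h1 h2 h3 => hdiff w (hBG (hmem w h1 (by linarith) h3)))
    (fun w h1 h2 h3 => hK w (hmem w h1 (by linarith) h3)) hflatθ
  have hzero := flat_zero f (-T) y0 x1 k c' C' K hk0 (by linarith) hc' hC'
    (fun w h1 h2 h3 => hdiff w (hBG (hmem w h1 h2 (by linarith))))
    (fun w h1 h2 h3 => hK w (hmem w h1 h2 (by linarith))) hflat'
  have hpk0 : 0 < π / (2 * k) := by positivity
  have hpk2 : π / k = π / (2 * k) + π / (2 * k) := by field_simp; ring
  set z0 : ℂ := ⟨x1 - 1, y0 - π / (2 * k)⟩ with hz0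
  have hz0G : z0 ∈ G := hBG (hmem z0 (by simp [hz0]) (by simp only [hz0]; linarith)
    (by simp only [hz0]; linarith))
  have hfreq : ∃ᶠ z in 𝓝[≠] z0, f z = 0 := by
    have ht : Tendsto (fun s : ℝ => z0 - (s : ℂ)) (𝓝[>] 0) (𝓝[≠] z0) := by
      rw [tendsto_nhdsWithin_iff]
      constructor
      · have hcont : Continuous fun s : ℝ => z0 - (s : ℂ) := by fun_prop
        have := (hcont.tendsto 0).mono_left (nhdsWithin_le_nhds (s := Ioi 0))
        simpa using this
      · filter_upwards [self_mem_nhdsWithin] with s hs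
        have : s ≠ 0 := (ne_of_gt hs)
        simpa using this
    apply ht.frequently
    apply Eventually.frequently
    filter_upwards [self_mem_nhdsWithin] with s hs
    have hs' : 0 < s := hs
    apply hzero
    · simp [hz0]; linarith
    · simp [hz0]
  exact fun w hw => (hf.analyticOnNhd hGo).eqOn_zero_of_preconnected_of_frequently_eq_zero
    hGc.isPreconnected hz0G hfreq hw
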